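/- arXiv:1011.3489 — 3 statements merged into one kernel-verified Lean document; each statement's English description precedes it below -/
import Mathlib

section
/- Let K > 0 and Y > 0 be real, let Υ : ℝ → ℝ be differentiable and strictly positive on [t, t+δ] with |Υ′(s)| ≤ K²·Υ(s)² for all s ∈ [t, t+δ], where δ := 1/(Υ(t)·(Y + K²)). Then for every s ∈ [t, t+δ], Υ(s)·δ ≤ 1/Y; in particular (max_{s ∈ [t, t+δ]} Υ(s))·δ ≤ 1/Y. -/
/-- A positive function with derivative at most `C f²` in absolute value on an interval has a
reciprocal that decreases at rate at most `C` there. -/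
theorem inv_sub_le_inv_of_abs_derivWithin_le_sq {f : ℝ → ℝ} {a b C s : ℝ}
    (hdiff : DifferentiableOn ℝ f (Set.Icc a b)) (hpos : ∀ x ∈ Set.Icc a b, 0 < f x)
    (hbd : ∀ x ∈ Set.Icc a b, |derivWithin f (Set.Icc a b) x| ≤ C * f x ^ 2)
    (hs : s ∈ Set.Icc a b) : (f a)⁻¹ - C * (s - a) ≤ (f s)⁻¹ := by
  have ha : a ∈ Set.Icc a b := ⟨le_rfl, hs.1.trans hs.2⟩
  have h := (convex_Icc a b).norm_image_sub_le_of_norm_hasDerivWithin_le (C := C)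
    (fun x hx => (hdiff x hx).hasDerivWithinAt.inv (hpos x hx).ne')
    (fun x hx => by
      rw [norm_div, norm_neg, Real.norm_eq_abs, norm_pow, Real.norm_eq_abs, sq_abs]
      exact (div_le_iff₀ (pow_pos (hpos x hx) 2)).2 (hbd x hx)) ha hs
  rw [Real.norm_eq_abs, Real.norm_eq_abs, abs_of_nonneg (sub_nonneg.2 hs.1)] at h
  have := (abs_le.1 h).1
  simp only [Pi.inv_apply] at this
  linarith

/-- If `Υ` is differentiable and strictly positive on `[t, t+δ]` with `|Υ′(s)| ≤ K²·Υ(s)²`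
there, where `δ = 1/(Υ(t)·(Y + K²))` is the adaptive time-step, then `Υ(s)·δ ≤ 1/Y` for every
`s ∈ [t, t+δ]`; in particular `(max_{s ∈ [t,t+δ]} Υ(s))·δ ≤ 1/Y`. -/
theorem stmt8 (K Y δ t : ℝ) (hK : 0 < K) (hY : 0 < Y) (Υ : ℝ → ℝ)
    (hδ : δ = 1 / (Υ t * (Y + K ^ 2)))
    (hdiff : DifferentiableOn ℝ Υ (Set.Icc t (t + δ)))
    (hpos : ∀ s ∈ Set.Icc t (t + δ), 0 < Υ s)
    (hbd : ∀ s ∈ Set.Icc t (t + δ),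
      |derivWithin Υ (Set.Icc t (t + δ)) s| ≤ K ^ 2 * (Υ s) ^ 2) :
    (∀ s ∈ Set.Icc t (t + δ), Υ s * δ ≤ 1 / Y) ∧
      sSup (Υ '' Set.Icc t (t + δ)) * δ ≤ 1 / Y := by
  have hmain : ∀ s ∈ Set.Icc t (t + δ), Υ s * δ ≤ 1 / Y := by
    intro s hs
    have hΥt : 0 < Υ t := hpos t ⟨le_rfl, hs.1.trans hs.2⟩
    have hΥs := hpos s hs
    have hinv := inv_sub_le_inv_of_abs_derivWithin_le_sq hdiff hpos hbd hs
    have hδt : (Υ t)⁻¹ = δ * (Y + K ^ 2) := by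
      rw [hδ]
      field_simp
    have hstep : K ^ 2 * (s - t) ≤ K ^ 2 * δ :=
      mul_le_mul_of_nonneg_left (by linarith [hs.2]) (sq_nonneg K)
    have hle : δ * Y ≤ (Υ s)⁻¹ := by linarith
    rw [le_div_iff₀ hY, mul_assoc]
    exact (mul_le_mul_of_nonneg_left hle hΥs.le).trans_eq (mul_inv_cancel₀ hΥs.ne')
  refine ⟨hmain, ?_⟩
  rcases (Set.Icc t (t + δ)).eq_empty_or_nonempty with hempty | hne
  · simp [hempty, hY.le]
  · have ht : t ∈ Set.Icc t (t + δ) := Set.left_mem_Icc.2 (Set.nonempty_Icc.1 hne)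
    have hΥt : 0 < Υ t := hpos t ht
    have hδpos : 0 < δ := by
      rw [hδ]
      positivity
    rw [← le_div_iff₀ hδpos]
    refine csSup_le (hne.image Υ) ?_
    rintro _ ⟨s, hs, rfl⟩
    exact (le_div_iff₀ hδpos).2 (hmain s hs)
end

section
/- Let K > 0, Y > 0, Δt > 0 and t₀ be real, and let Υ : ℝ → ℝ be differentiable and strictly positive on [t₀, t₀+Δt] with |Υ′(s)| ≤ K²·Υ(s)² for all s ∈ [t₀, t₀+Δt]. Let r ≥ 1 be an integer and t₀ < t₁ < ⋯ < t_r = t₀ + Δt be real numbers such that t_{p+1} = t_p + 1/(Υ(t_p)·(Y + K²)) for p = 0, 1, …, r−2. Then r ≤ (Y + 2K²)·∫_{t₀}^{t₀+Δt} Υ(s) ds + 1. -/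
open Set in
/-- If `|f'| ≤ C f²` for a positive `f`, then `1 / f` is `C`-Lipschitz. -/
theorem abs_inv_sub_inv_le_of_abs_derivWithin_le_mul_sq {f : ℝ → ℝ} {S : Set ℝ} {C x y : ℝ}
    (hS : Convex ℝ S) (hf : DifferentiableOn ℝ f S) (hpos : ∀ s ∈ S, 0 < f s)
    (hbd : ∀ s ∈ S, |derivWithin f S s| ≤ C * f s ^ 2) (hx : x ∈ S) (hy : y ∈ S) :
    |(f y)⁻¹ - (f x)⁻¹| ≤ C * |y - x| := by
  have hderiv : ∀ s ∈ S,
      HasDerivWithinAt (fun z => (f z)⁻¹) (-derivWithin f S s / f s ^ 2) S s :=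
    fun s hs => (hf s hs).hasDerivWithinAt.fun_inv (hpos s hs).ne'
  refine hS.norm_image_sub_le_of_norm_hasDerivWithin_le hderiv (fun s hs => ?_) hx hy
  have := pow_pos (hpos s hs) 2
  rw [Real.norm_eq_abs, abs_div, abs_neg, abs_of_pos this, div_le_iff₀ this]
  exact hbd s hs

open Set in
/-- Over a step of length `1 / (f a * (Y + C))`, a positive function with `|f'| ≤ C f²` has
integral at least `1 / (Y + 2 * C)`. -/
theorem one_le_mul_integral_of_abs_derivWithin_le_mul_sq {f : ℝ → ℝ} {S : Set ℝ} {C Y a b : ℝ}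
    (hC : 0 < C) (hY : 0 < Y) (hS : Convex ℝ S) (hf : DifferentiableOn ℝ f S)
    (hpos : ∀ s ∈ S, 0 < f s) (hbd : ∀ s ∈ S, |derivWithin f S s| ≤ C * f s ^ 2)
    (hab : Icc a b ⊆ S) (hle : a ≤ b) (hb : b = a + 1 / (f a * (Y + C))) :
    1 ≤ (Y + 2 * C) * ∫ s in a..b, f s := by
  have ha : a ∈ S := hab ⟨le_rfl, hle⟩
  have hfa := hpos a ha
  have hlow : ∀ s ∈ Icc a b, f a * (Y + C) / (Y + 2 * C) ≤ f s := by
    intro s hs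
    have hfs := hpos s (hab hs)
    have hlip := (le_abs_self _).trans
      (abs_inv_sub_inv_le_of_abs_derivWithin_le_mul_sq hS hf hpos hbd ha (hab hs))
    rw [abs_of_nonneg (sub_nonneg.2 hs.1)] at hlip
    have hstep : C * (s - a) ≤ C * (1 / (f a * (Y + C))) :=
      mul_le_mul_of_nonneg_left (by linarith [hs.2]) hC.le
    have hinv : (f s)⁻¹ ≤ (f a * (Y + C) / (Y + 2 * C))⁻¹ := by
      have : (f a * (Y + C) / (Y + 2 * C))⁻¹ = (f a)⁻¹ + C * (1 / (f a * (Y + C))) := by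
        field_simp
        ring
      linarith
    exact (inv_le_inv₀ hfs (by positivity)).1 hinv
  have hint : IntervalIntegrable f MeasureTheory.volume a b :=
    (hf.continuousOn.mono hab).intervalIntegrable_of_Icc hle
  have hmono := intervalIntegral.integral_mono_on hle intervalIntegrable_const hint hlow
  rw [intervalIntegral.integral_const, smul_eq_mul,
    show b - a = 1 / (f a * (Y + C)) by rw [hb]; ring] at hmono
  calc (1 : ℝ) = (Y + 2 * C) * (1 / (f a * (Y + C)) * (f a * (Y + C) / (Y + 2 * C))) := by
        field_simp
    _ ≤ _ := mul_le_mul_of_nonneg_left hmono (by positivity)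

/-- If `Υ` is differentiable and strictly positive on `[t₀, t₀+Δt]` with `|Υ′(s)| ≤ K²·Υ(s)²`
there, and `t₀ < t₁ < ⋯ < t_r = t₀+Δt` are adaptive time steps obeying the recurrence
`t_{p+1} = t_p + 1/(Υ(t_p)·(Y + K²))` for `p = 0,…,r−2`, then
`r ≤ (Y + 2K²)·∫_{t₀}^{t₀+Δt} Υ(s) ds + 1`. -/
theorem stmt9 (K Y Δt t₀ : ℝ) (hK : 0 < K) (hY : 0 < Y) (hΔt : 0 < Δt) (Υ : ℝ → ℝ)
    (hdiff : DifferentiableOn ℝ Υ (Set.Icc t₀ (t₀ + Δt)))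
    (hpos : ∀ s ∈ Set.Icc t₀ (t₀ + Δt), 0 < Υ s)
    (hbd : ∀ s ∈ Set.Icc t₀ (t₀ + Δt),
      |derivWithin Υ (Set.Icc t₀ (t₀ + Δt)) s| ≤ K ^ 2 * (Υ s) ^ 2)
    (r : ℕ) (hr : 1 ≤ r) (ts : ℕ → ℝ)
    (h0 : ts 0 = t₀) (hlast : ts r = t₀ + Δt)
    (hmono : ∀ p < r, ts p < ts (p + 1))
    (hrec : ∀ p, p + 2 ≤ r → ts (p + 1) = ts p + 1 / (Υ (ts p) * (Y + K ^ 2))) :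
    (r : ℝ) ≤ (Y + 2 * K ^ 2) * (∫ s in t₀..(t₀ + Δt), Υ s) + 1 := by
  have hts : ∀ p m, p ≤ m → m ≤ r → ts p ≤ ts m := by
    intro p m hpm
    induction m, hpm using Nat.le_induction with
    | base => exact fun _ => le_rfl
    | succ m _ ih => exact fun hm => (ih (by omega)).trans (hmono m (by omega)).le
  have hsub : ∀ p m, p ≤ r → m ≤ r →
      Set.Icc (ts p) (ts m) ⊆ Set.Icc t₀ (t₀ + Δt) := fun p m hp hm =>
    Set.Icc_subset_Icc (h0 ▸ hts 0 p (Nat.zero_le p) hp) (hlast ▸ hts m r hm le_rfl)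
  have hint : ∀ p m, p ≤ m → m ≤ r →
      IntervalIntegrable Υ MeasureTheory.volume (ts p) (ts m) := fun p m hpm hm =>
    (hdiff.continuousOn.mono (hsub p m (hpm.trans hm) hm)).intervalIntegrable_of_Icc
      (hts p m hpm hm)
  have hcount : ∀ p, p + 1 ≤ r → (p : ℝ) ≤ (Y + 2 * K ^ 2) * ∫ s in ts 0..ts p, Υ s := by
    intro p
    induction p with
    | zero => simp
    | succ p ih =>
      intro hp
      have hstep := one_le_mul_integral_of_abs_derivWithin_le_mul_sq (pow_pos hK 2) hY
        (convex_Icc t₀ (t₀ + Δt)) hdiff hpos hbd (hsub p (p + 1) (by omega) (by omega))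
        (hmono p (by omega)).le (hrec p hp)
      rw [← intervalIntegral.integral_add_adjacent_intervals
        (hint 0 p (by omega) (by omega)) (hint p (p + 1) (by omega) (by omega)), mul_add]
      push_cast
      linarith [ih (by omega)]
  obtain ⟨n, rfl⟩ : ∃ n, r = n + 1 := ⟨r - 1, by omega⟩
  have hlaststep : 0 ≤ ∫ s in ts n..ts (n + 1), Υ s :=
    intervalIntegral.integral_nonneg (hmono n (by omega)).le fun s hs =>
      (hpos s (hsub n (n + 1) (by omega) le_rfl hs)).le
  rw [← hlast, ← h0, ← intervalIntegral.integral_add_adjacent_intervals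
    (hint 0 n (by omega) (by omega)) (hint n (n + 1) (by omega) le_rfl), mul_add]
  have : 0 ≤ (Y + 2 * K ^ 2) * ∫ s in ts n..ts (n + 1), Υ s := by positivity
  push_cast
  linarith [hcount n le_rfl]
end

section
/- Let A > 0 and B ≥ 0 be real numbers, let k ≥ 1 be an integer, and set r_g := ⌈A + 3B + 1⌉. Then ⌈A^{2k/(2k+1)} · r_g^{1/(2k+1)} + 2B + 1/3⌉ ≤ r_g. -/
/-- For `A > 0`, `B ≥ 0`, an integer `k ≥ 1` and `r_g := ⌈A + 3B + 1⌉`, the fixed-point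
inequality `⌈A^{2k/(2k+1)} · r_g^{1/(2k+1)} + 2B + 1/3⌉ ≤ r_g` holds. -/
theorem stmt10 (A B : ℝ) (hA : 0 < A) (hB : 0 ≤ B) (k : ℕ) (hk : 1 ≤ k) :
    ⌈A ^ ((2 * (k : ℝ)) / (2 * (k : ℝ) + 1)) *
        ((⌈A + 3 * B + 1⌉ : ℤ) : ℝ) ^ ((1 : ℝ) / (2 * (k : ℝ) + 1)) +
        2 * B + 1 / 3⌉ ≤ ⌈A + 3 * B + 1⌉ := by
  have hk' : (1 : ℝ) ≤ k := by exact_mod_cast hk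
  have hr : A + 3 * B + 1 ≤ ((⌈A + 3 * B + 1⌉ : ℤ) : ℝ) := Int.le_ceil _
  rw [Int.ceil_le]
  set r : ℝ := ((⌈A + 3 * B + 1⌉ : ℤ) : ℝ)
  set θ : ℝ := 2 * (k : ℝ) / (2 * (k : ℝ) + 1) with hθ
  have hsub : (1 : ℝ) / (2 * (k : ℝ) + 1) = 1 - θ := by
    rw [hθ]
    field_simp
    ring
  have hθ_ge : 2 / 3 ≤ θ := by
    rw [hθ, div_le_div_iff₀ (by norm_num) (by positivity)]
    linarith
  have hθ_le : 0 ≤ 1 - θ := by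
    rw [← hsub]
    positivity
  have amgm : A ^ θ * r ^ (1 - θ) ≤ θ * A + (1 - θ) * r :=
    Real.geom_mean_le_arith_mean2_weighted (by linarith) hθ_le hA.le (by linarith) (by ring)
  have hθr : θ * (A + 3 * B + 1) ≤ θ * r := mul_le_mul_of_nonneg_left hr (by linarith)
  have hθB : 2 / 3 * B ≤ θ * B := mul_le_mul_of_nonneg_right hθ_ge hB
  rw [hsub]
  linarith
end
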